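/- Let X and Y be nonempty compact metric spaces with 1-Lipschitz functions τ_X : X → ℝ and τ_Y : Y → ℝ, and let u : ℕ → X and v : ℕ → Y be sequences with dense range. If the timed-Kuratowski maps have the same image, i.e. Set.range κ_{τ_X,u} = Set.range κ_{τ_Y,v} as subsets of ℝ × ℓ^∞, then there exists a bijection F : X → Y which is an isometry, satisfies τ_Y ∘ F = τ_X, and satisfies κ_{τ_Y,v} ∘ F = κ_{τ_X,u}. -/

import Mathlib

open Metric ENNReal

/-- The Kuratowski map of a compact metric space into `ℓ^∞`, defined from a sequence of
points: `x ↦ (n ↦ dist (u n) x)`. -/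
noncomputable def kuratowskiMap {X : Type*} [MetricSpace X] [CompactSpace X]
    (u : ℕ → X) (x : X) : lp (fun _ : ℕ => ℝ) ∞ :=
  ⟨fun n => dist (u n) x, memℓp_infty ⟨Metric.diam (Set.univ : Set X), by
    rintro r ⟨n, rfl⟩
    simpa [Real.norm_eq_abs, abs_of_nonneg dist_nonneg] using
      Metric.dist_le_diam_of_mem isCompact_univ.isBounded (Set.mem_univ (u n))
        (Set.mem_univ x)⟩⟩

/-- The timed-Kuratowski map `x ↦ (τ x, (n ↦ dist (u n) x))` into `ℝ × ℓ^∞`,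
where the product carries the max product distance. -/
noncomputable def timedKuratowskiMap {X : Type*} [MetricSpace X] [CompactSpace X]
    (τ : X → ℝ) (u : ℕ → X) (x : X) : ℝ × lp (fun _ : ℕ => ℝ) ∞ :=
  (τ x, kuratowskiMap u x)

/-- The Kuratowski map of a dense sequence is an isometric embedding. -/
theorem isometry_kuratowskiMap {X : Type*} [MetricSpace X] [CompactSpace X]
    {u : ℕ → X} (hu : DenseRange u) : Isometry (kuratowskiMap u) := by
  refine Isometry.of_dist_eq fun x y => le_antisymm ?_ ?_
  · rw [dist_eq_norm]
    refine lp.norm_le_of_forall_le dist_nonneg fun n => ?_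
    change |dist (u n) x - dist (u n) y| ≤ dist x y
    rw [dist_comm (u n) x, dist_comm (u n) y]
    exact abs_dist_sub_le x y (u n)
  · refine le_of_forall_pos_le_add fun ε hε => ?_
    obtain ⟨n, hn⟩ := hu.exists_dist_lt x (half_pos hε)
    have hcoord : |dist (u n) x - dist (u n) y| ≤ dist (kuratowskiMap u x) (kuratowskiMap u y) := by
      rw [dist_eq_norm]
      exact lp.norm_apply_le_norm ENNReal.top_ne_zero (kuratowskiMap u x - kuratowskiMap u y) n
    have htri := dist_triangle x (u n) y
    rw [dist_comm x (u n)] at hn htri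
    linarith [(abs_le.mp hcoord).1]

/-- The timed-Kuratowski map of a `1`-Lipschitz function and a dense sequence is an isometric
embedding. -/
theorem isometry_timedKuratowskiMap {X : Type*} [MetricSpace X] [CompactSpace X]
    {τ : X → ℝ} (hτ : LipschitzWith 1 τ) {u : ℕ → X} (hu : DenseRange u) :
    Isometry (timedKuratowskiMap τ u) := by
  refine Isometry.of_dist_eq fun x y => ?_
  rw [Prod.dist_eq]
  change max (dist (τ x) (τ y)) (dist (kuratowskiMap u x) (kuratowskiMap u y)) = dist x y
  rw [(isometry_kuratowskiMap hu).dist_eq]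
  exact max_eq_right (by simpa using hτ.dist_le_mul x y)

/-- If two timed-Kuratowski maps have the same image in `ℝ × ℓ^∞`, then there is a
distance and time preserving bijection `F : X → Y` compatible with the two maps. -/
theorem timedKuratowski_same_image_bijection {X Y : Type*}
    [MetricSpace X] [CompactSpace X] [Nonempty X]
    [MetricSpace Y] [CompactSpace Y] [Nonempty Y]
    (τX : X → ℝ) (τY : Y → ℝ) (hτX : LipschitzWith 1 τX) (hτY : LipschitzWith 1 τY)
    (u : ℕ → X) (v : ℕ → Y) (hu : DenseRange u) (hv : DenseRange v)
    (h : Set.range (timedKuratowskiMap τX u) = Set.range (timedKuratowskiMap τY v)) :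
    ∃ F : X → Y, Function.Bijective F ∧
      (∀ x₁ x₂ : X, dist (F x₁) (F x₂) = dist x₁ x₂) ∧
      (∀ x : X, τY (F x) = τX x) ∧
      (∀ x : X, timedKuratowskiMap τY v (F x) = timedKuratowskiMap τX u x) := by
  have hX := isometry_timedKuratowskiMap hτX hu
  have hY := isometry_timedKuratowskiMap hτY hv
  have hex (x : X) : ∃ y, timedKuratowskiMap τY v y = timedKuratowskiMap τX u x := by
    rw [← Set.mem_range, ← h]
    exact Set.mem_range_self x
  choose F hF using hex
  have hdist (x₁ x₂ : X) : dist (F x₁) (F x₂) = dist x₁ x₂ := by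
    rw [← hY.dist_eq, hF, hF, hX.dist_eq]
  refine ⟨F, ⟨(Isometry.of_dist_eq hdist).injective, fun y => ?_⟩, hdist,
    fun x => congrArg Prod.fst (hF x), hF⟩
  obtain ⟨x, hx⟩ : timedKuratowskiMap τY v y ∈ Set.range (timedKuratowskiMap τX u) := by
    rw [h]
    exact Set.mem_range_self y
  exact ⟨x, hY.injective ((hF x).trans hx)⟩
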